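/- For the complete binary tree T^h of height h, the optimal pebbling number is π*(T^h) = 2^h − k(h), where k(h) = max{k : s(k) ≤ 2^h}. -/

import Mathlib

/-- `Alist k` is the list `A_{k+1}`: `A_1 = [5]`, `A_{k+1} = A_k ++ A_k ++ [1]`. -/
def Alist : ℕ → List ℕ
  | 0 => [5]
  | k+1 => Alist k ++ Alist k ++ [1]

/-- `aseq n` is the `n`-th term (1-indexed) of the limit of the lists `A_k`;
`aseq 0 = 0` by convention. -/
def aseq (n : ℕ) : ℕ := (Alist n).getD (n - 1) 0

/-- Partial sums: `s n = a_1 + ⋯ + a_n`, `s 0 = 0`. -/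
def s (n : ℕ) : ℕ := ∑ i ∈ Finset.Icc 1 n, aseq i

/-- `k(h) = max {k : s k ≤ 2^h}` (all such `k` are at most `2^h` since `s k ≥ k`). -/
def kOf (h : ℕ) : ℕ := Nat.findGreatest (fun k => s k ≤ 2 ^ h) (2 ^ h)

/-- Vertices of the complete binary tree `T^h` of height `h` are the heap
indices `1 ≤ v < 2^(h+1)`; the root is `1`, the vertices at level `i` are
those with `2^i ≤ v < 2^(i+1)`, and the parent of `v` is `v / 2`.
A pebbling move removes two pebbles from a vertex `u` and places one pebble
on an adjacent vertex `v`. -/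
def PebMove (h : ℕ) (f g : ℕ → ℕ) : Prop :=
  ∃ u v : ℕ, (1 ≤ u ∧ u < 2 ^ (h + 1)) ∧ (1 ≤ v ∧ v < 2 ^ (h + 1)) ∧
    (u = v / 2 ∨ v = u / 2) ∧ 2 ≤ f u ∧
    g = fun w => if w = u then f u - 2 else if w = v then f v + 1 else f w

/-- `f` pebbles `T^h`: for every vertex there is a sequence of pebbling moves
bringing a pebble to it. -/
def Pebbles (h : ℕ) (f : ℕ → ℕ) : Prop :=
  ∀ v : ℕ, 1 ≤ v → v < 2 ^ (h + 1) →
    ∃ g : ℕ → ℕ, Relation.ReflTransGen (PebMove h) f g ∧ 1 ≤ g v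

/-! ### Binary digit sums -/

/-- The sum of the binary digits of `n`. -/
def bitSum (n : ℕ) : ℕ := (Nat.digits 2 n).sum

theorem bitSum_zero : bitSum 0 = 0 := by simp [bitSum]

theorem bitSum_eq (n : ℕ) : bitSum n = n % 2 + bitSum (n / 2) := by
  rcases Nat.eq_zero_or_pos n with rfl | hn
  · simp [bitSum]
  · simp [bitSum, Nat.digits_def' one_lt_two hn]

theorem bitSum_le (n : ℕ) : bitSum n ≤ n := Nat.digit_sum_le 2 n

theorem bitSum_succ_le (n : ℕ) : bitSum (n + 1) ≤ bitSum n + 1 := by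
  induction n using Nat.strong_induction_on with
  | _ n ih =>
    have h1 := bitSum_eq n
    have h2 := bitSum_eq (n + 1)
    rcases Nat.even_or_odd' n with ⟨k, rfl | rfl⟩
    · rw [show (2 * k + 1) / 2 = k by omega] at h2
      rw [show (2 * k) / 2 = k by omega] at h1
      omega
    · rw [show (2 * k + 1 + 1) / 2 = k + 1 by omega] at h2
      rw [show (2 * k + 1) / 2 = k by omega] at h1
      have := ih k (by omega)
      omega

theorem bitSum_two_pow_add (t j : ℕ) (hj : j < 2 ^ t) :
    bitSum (2 ^ t + j) = 1 + bitSum j := by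
  induction t generalizing j with
  | zero =>
    obtain rfl : j = 0 := by simpa using hj
    simp [bitSum]
  | succ t ih =>
    have h1 := bitSum_eq j
    have h2 := bitSum_eq (2 ^ (t + 1) + j)
    rw [pow_succ] at *
    rw [show (2 ^ t * 2 + j) / 2 = 2 ^ t + j / 2 by omega, ih _ (by omega)] at h2
    omega

/-- The largest `k` for which `a_1, …, a_k` contains at most `j` fives. -/
def fiveRank (j : ℕ) : ℕ := 2 * j - bitSum j

theorem fiveRank_add_bitSum (j : ℕ) : fiveRank j + bitSum j = 2 * j := by
  have := bitSum_le j
  unfold fiveRank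
  omega

theorem fiveRank_strictMono : StrictMono fiveRank :=
  strictMono_nat_of_lt_succ fun j => by
    have h1 := fiveRank_add_bitSum j
    have h2 := fiveRank_add_bitSum (j + 1)
    have h3 := bitSum_succ_le j
    omega

theorem fiveRank_two_pow_add (t j : ℕ) (hj : j < 2 ^ t) :
    fiveRank (2 ^ t + j) = 2 ^ (t + 1) - 1 + fiveRank j := by
  have h1 := fiveRank_add_bitSum j
  have h2 := fiveRank_add_bitSum (2 ^ t + j)
  have h3 := bitSum_two_pow_add t j hj
  have h4 : 2 ^ (t + 1) = 2 * 2 ^ t := pow_succ' 2 t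
  omega

theorem fiveRank_two_pow (t : ℕ) : fiveRank (2 ^ t) = 2 ^ (t + 1) - 1 := by
  have := fiveRank_two_pow_add t 0 (by positivity)
  simpa [fiveRank, bitSum_zero] using this

/-! ### The sequence `s` -/

theorem length_Alist (t : ℕ) : (Alist t).length = 2 ^ (t + 1) - 1 := by
  induction t with
  | zero => rfl
  | succ t ih =>
    have : 0 < 2 ^ (t + 1) := by positivity
    rw [Alist, List.length_append, List.length_append, ih, pow_succ 2 (t + 1)]
    simp only [List.length_singleton]
    omega

theorem sum_Alist (t : ℕ) : (Alist t).sum = 4 * 2 ^ t + (2 ^ (t + 1) - 1) := by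
  induction t with
  | zero => rfl
  | succ t ih =>
    have : 0 < 2 ^ (t + 1) := by positivity
    rw [Alist, List.sum_append, List.sum_append, ih, pow_succ 2 (t + 1), pow_succ 2 t]
    simp only [List.sum_singleton]
    omega

theorem Alist_prefix {m n : ℕ} (h : m ≤ n) : Alist m <+: Alist n := by
  induction n, h using Nat.le_induction with
  | base => exact List.prefix_refl _
  | succ n _ ih => exact ih.trans ⟨Alist n ++ [1], by simp [Alist]⟩

theorem s_eq_sum_take (k t : ℕ) (h : k ≤ t) : s k = ((Alist t).take k).sum := by
  induction k with
  | zero => simp [s]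
  | succ k ih =>
    have hlt : k + 1 < 2 ^ (k + 1 + 1) - 1 := by
      have : k + 1 < 2 ^ (k + 1) := Nat.lt_two_pow_self
      rw [pow_succ]
      omega
    have hk : k < (Alist (k + 1)).length := by rw [length_Alist]; omega
    have hk' : k < (Alist t).length := hk.trans_le (Alist_prefix h).length_le
    have hs : s (k + 1) = s k + aseq (k + 1) := by
      simp [s, Finset.sum_Icc_succ_top]
    rw [hs, ih (by omega), List.sum_take_succ _ _ hk', aseq]
    simp only [Nat.add_sub_cancel]
    rw [List.getD_eq_getElem _ _ hk, (Alist_prefix h).getElem hk]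

theorem le_sum_take_Alist (t k : ℕ) (hk : k ≤ 2 ^ (t + 1) - 1) :
    k ≤ ((Alist t).take k).sum := by
  have hpos : ∀ t, ∀ x ∈ Alist t, 1 ≤ x := by
    intro t
    induction t with
    | zero => simp [Alist]
    | succ t ih =>
      intro x hx
      simp only [Alist, List.mem_append, List.mem_singleton] at hx
      rcases hx with (hx | hx) | rfl
      · exact ih x hx
      · exact ih x hx
      · rfl
  have := List.card_nsmul_le_sum ((Alist t).take k) 1
    (fun x hx => hpos t x (List.mem_of_mem_take hx))
  simpa [length_Alist, hk] using this

theorem sum_take_Alist_le_iff (t k r : ℕ) (hk : k ≤ 2 ^ (t + 1) - 1) :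
    ((Alist t).take k).sum ≤ k + r ↔ k ≤ fiveRank (r / 4) := by
  have key : ∀ t r, 4 * 2 ^ t ≤ r ↔ 2 ^ (t + 1) - 1 ≤ fiveRank (r / 4) := by
    intro t r
    rw [← fiveRank_two_pow, fiveRank_strictMono.le_iff_le]
    omega
  induction t generalizing k r with
  | zero =>
    have h0 := key 0 r
    obtain rfl | rfl : k = 0 ∨ k = 1 := by simp at hk; omega
    · simp
    · simp only [Alist, List.take_succ_cons, List.take_nil, List.sum_singleton]
      simp only [pow_zero, zero_add, pow_one] at h0
      omega
  | succ t ih =>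
    have hl := length_Alist t
    have hpos : 0 < 2 ^ t := by positivity
    have e1 : 2 ^ (t + 1) = 2 * 2 ^ t := pow_succ' 2 t
    have e2 : 2 ^ (t + 1 + 1) = 2 * 2 ^ (t + 1) := pow_succ' 2 (t + 1)
    rcases le_or_gt k (2 ^ (t + 1) - 1) with hk1 | hk1
    · rw [Alist, List.append_assoc, List.take_append_of_le_length (by omega)]
      exact ih k r hk1
    · rcases hk.lt_or_eq with hk2 | rfl
      · obtain ⟨i, rfl⟩ := Nat.exists_eq_add_of_le hk1.le
        have hi : i ≤ 2 ^ (t + 1) - 1 := by omega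
        have hS : ((Alist (t + 1)).take (2 ^ (t + 1) - 1 + i)).sum =
            4 * 2 ^ t + (2 ^ (t + 1) - 1) + ((Alist t).take i).sum := by
          rw [Alist, List.append_assoc, ← hl, List.take_length_add_append,
            List.take_append_of_le_length (by omega), List.sum_append, sum_Alist, hl]
        rw [hS]
        have hle := le_sum_take_Alist t i hi
        have hmono := key t r
        rcases lt_or_ge r (4 * 2 ^ t) with hr | hr
        · omega
        · obtain ⟨r', rfl⟩ := Nat.exists_eq_add_of_le hr
          have h1 := ih i r' hi
          have h2 := key t r'
          have h3 := key (t + 1) (4 * 2 ^ t + r')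
          have h4 : (4 * 2 ^ t + r') / 4 = 2 ^ t + r' / 4 := by omega
          rcases lt_or_ge (r' / 4) (2 ^ t) with hr' | hr'
          · rw [h4, fiveRank_two_pow_add t _ hr']
            omega
          · omega
      · have h := key (t + 1) r
        rw [List.take_of_length_le (by rw [length_Alist]), sum_Alist]
        omega

theorem s_le_iff {k n : ℕ} (h : k ≤ n) : s k ≤ n ↔ k ≤ fiveRank ((n - k) / 4) := by
  have hk : k ≤ 2 ^ (k + 1) - 1 := by
    have : k < 2 ^ k := Nat.lt_two_pow_self
    rw [pow_succ]
    omega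
  have := sum_take_Alist_le_iff k k (n - k) hk
  rwa [← s_eq_sum_take k k le_rfl, Nat.add_sub_cancel' h] at this

/-! ### Moving pebbles -/

/-- `f` can bring at least `n` pebbles to `v`. -/
def Can (h : ℕ) (f : ℕ → ℕ) (v n : ℕ) : Prop :=
  ∃ g : ℕ → ℕ, Relation.ReflTransGen (PebMove h) f g ∧ n ≤ g v

theorem PebMove.add_right {h : ℕ} {f g : ℕ → ℕ} (e : ℕ → ℕ) (m : PebMove h f g) :
    PebMove h (f + e) (g + e) := by
  obtain ⟨u, v, hu, hv, huv, h2, rfl⟩ := m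
  refine ⟨u, v, hu, hv, huv, by simp only [Pi.add_apply]; omega, ?_⟩
  funext w
  simp only [Pi.add_apply]
  split_ifs with h1 h3
  · subst h1; omega
  · subst h3; omega
  · rfl

theorem reflTransGen_add_right {h : ℕ} {f g : ℕ → ℕ} (e : ℕ → ℕ)
    (m : Relation.ReflTransGen (PebMove h) f g) :
    Relation.ReflTransGen (PebMove h) (f + e) (g + e) :=
  Relation.ReflTransGen.lift (· + e) (fun _ _ => PebMove.add_right e) _ _ m

theorem Can.mono {h : ℕ} {f f' : ℕ → ℕ} {v n n' : ℕ} (c : Can h f v n) (hf : f ≤ f')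
    (hn : n' ≤ n) : Can h f' v n' := by
  obtain ⟨g, hg, hgv⟩ := c
  refine ⟨g + (f' - f), ?_, ?_⟩
  · have := reflTransGen_add_right (f' - f) hg
    rwa [add_tsub_cancel_of_le hf] at this
  · exact (hn.trans hgv).trans (Nat.le_add_right _ _)

theorem Can.add {h : ℕ} {f f' : ℕ → ℕ} {v n n' : ℕ} (c : Can h f v n) (c' : Can h f' v n') :
    Can h (f + f') v (n + n') := by
  obtain ⟨g, hg, hgv⟩ := c
  obtain ⟨g', hg', hgv'⟩ := c'
  refine ⟨g + g', (reflTransGen_add_right f' hg).trans ?_, Nat.add_le_add hgv hgv'⟩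
  have := reflTransGen_add_right g hg'
  rwa [add_comm f', add_comm g'] at this

theorem can_single (h v n : ℕ) : Can h (Pi.single v n) v n :=
  ⟨_, .refl, by simp⟩

/-- A configuration carrying `n` pebbles at `v` moves half of them to a neighbour `w`. -/
theorem Can.move {h : ℕ} {f : ℕ → ℕ} {v w n : ℕ} (c : Can h f v n)
    (hv : 1 ≤ v ∧ v < 2 ^ (h + 1)) (hw : 1 ≤ w ∧ w < 2 ^ (h + 1))
    (hvw : v = w / 2 ∨ w = v / 2) : Can h f w (n / 2) := by
  obtain ⟨g, hg, hgv⟩ := c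
  have hne : w ≠ v := by omega
  have main : ∀ k (g : ℕ → ℕ), 2 * k ≤ g v → Can h g w k := by
    intro k
    induction k with
    | zero => exact fun g _ => ⟨g, .refl, Nat.zero_le _⟩
    | succ k ih =>
      intro g hgk
      let g' : ℕ → ℕ := fun x => if x = v then g v - 2 else g x
      have hstep : PebMove h g (g' + Pi.single w 1) := by
        refine ⟨v, w, hv, hw, hvw, by omega, ?_⟩
        funext x
        by_cases hxv : x = v
        · subst hxv; simp [g', hne.symm]
        · by_cases hxw : x = w
          · subst hxw; simp [g', hxv]
          · simp [g', hxv, hxw]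
      obtain ⟨e, he, hek⟩ := (ih g' (by simp only [g', if_true]; omega)).add (can_single h w 1)
      exact ⟨e, .head hstep he, hek⟩
  obtain ⟨e, he, hek⟩ := main (n / 2) g (by omega)
  exact ⟨e, hg.trans he, hek⟩

/-- Once `f` can bring `n` pebbles to `v`, whatever `n` pebbles at `v` together with `e` can
do is within reach of `f + e`. -/
theorem Can.trans {h : ℕ} {f e : ℕ → ℕ} {v w n k : ℕ} (c : Can h f v n)
    (c' : Can h (Pi.single v n + e) w k) : Can h (f + e) w k := by
  obtain ⟨g, hg, hgv⟩ := c
  have hle : Pi.single v n ≤ g := by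
    intro x
    by_cases hx : x = v
    · subst hx; simpa using hgv
    · simp [hx]
  obtain ⟨g', hg', hk⟩ := c'.mono (f' := g + e) (by gcongr) le_rfl
  exact ⟨g', (reflTransGen_add_right e hg).trans hg', hk⟩

/-! ### The optimal configuration -/

/-- The configuration on the subtree of height `d` rooted at `v` placing `2 * bᵢ` pebbles on
every vertex at depth `i`, where `bᵢ` is the `i`-th binary digit of `q`. -/
def spread : ℕ → ℕ → ℕ → ℕ → ℕ
  | 0, q, v => Pi.single v (2 * (q % 2))
  | d + 1, q, v => Pi.single v (2 * (q % 2)) +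
      (spread d (q / 2) (2 * v) + spread d (q / 2) (2 * v + 1))

theorem sum_spread (h d q v : ℕ) (hq : q < 2 ^ (d + 1)) (hv : 1 ≤ v)
    (hvd : (v + 1) * 2 ^ d ≤ 2 ^ (h + 1)) :
    ∑ w ∈ Finset.Ico 1 (2 ^ (h + 1)), spread d q v w = 2 * q := by
  have hlt : v < 2 ^ (h + 1) :=
    (Nat.lt_succ_self v).trans_le ((Nat.le_mul_of_pos_right _ (by positivity)).trans hvd)
  have hmem : v ∈ Finset.Ico 1 (2 ^ (h + 1)) := Finset.mem_Ico.2 ⟨hv, hlt⟩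
  induction d generalizing q v with
  | zero =>
    rw [spread, Finset.sum_pi_single', if_pos hmem]
    omega
  | succ d ih =>
    rw [pow_succ] at hq
    have e : (v + 1) * 2 ^ (d + 1) = (2 * v + 1 + 1) * 2 ^ d := by ring
    have hR : (2 * v + 1 + 1) * 2 ^ d ≤ 2 ^ (h + 1) := e ▸ hvd
    have hL : (2 * v + 1) * 2 ^ d ≤ 2 ^ (h + 1) :=
      (Nat.mul_le_mul_right _ (Nat.le_succ _)).trans hR
    have hlt' : 2 * v + 1 < 2 ^ (h + 1) :=
      (Nat.lt_succ_self _).trans_le ((Nat.le_mul_of_pos_right _ (by positivity)).trans hR)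
    simp only [spread, Pi.add_apply, Finset.sum_add_distrib]
    rw [Finset.sum_pi_single', if_pos hmem,
      ih (q / 2) (2 * v) (by omega) (by omega) hL (by omega) (Finset.mem_Ico.2 (by omega)),
      ih (q / 2) (2 * v + 1) (by omega) (by omega) hR hlt' (Finset.mem_Ico.2 (by omega))]
    omega

theorem can_spread_root (h d q v : ℕ) (hq : q < 2 ^ (d + 1)) (hv : 1 ≤ v)
    (hvd : (v + 1) * 2 ^ d ≤ 2 ^ (h + 1)) : Can h (spread d q v) v (2 * bitSum q) := by
  induction d generalizing q v with
  | zero =>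
    have hb := bitSum_eq q
    rw [show q / 2 = 0 by omega, bitSum_zero] at hb
    rw [hb]
    exact can_single h v _
  | succ d ih =>
    rw [pow_succ] at hq
    have e : (v + 1) * 2 ^ (d + 1) = (2 * v + 1 + 1) * 2 ^ d := by ring
    have hR : (2 * v + 1 + 1) * 2 ^ d ≤ 2 ^ (h + 1) := e ▸ hvd
    have hL : (2 * v + 1) * 2 ^ d ≤ 2 ^ (h + 1) :=
      (Nat.mul_le_mul_right _ (Nat.le_succ _)).trans hR
    have hlt' : 2 * v + 1 < 2 ^ (h + 1) :=
      (Nat.lt_succ_self _).trans_le ((Nat.le_mul_of_pos_right _ (by positivity)).trans hR)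
    have cL := (ih (q / 2) (2 * v) (by omega) (by omega) hL).move (w := v)
      (by omega) (by omega) (by omega)
    have cR := (ih (q / 2) (2 * v + 1) (by omega) (by omega) hR).move (w := v)
      (by omega) (by omega) (by omega)
    have hb := bitSum_eq q
    exact ((can_single h v (2 * (q % 2))).add (cL.add cR)).mono le_rfl (by omega)

theorem can_spread (h d q v u w j : ℕ) (hq : q < 2 ^ d) (hv : 1 ≤ v)
    (hvd : (v + 1) * 2 ^ d ≤ 2 ^ (h + 1)) (hu : 2 ^ d + bitSum q ≤ u + 3 * q)
    (hj : j ≤ d) (hw : w / 2 ^ j = v) : Can h (Pi.single v u + spread d q v) w 1 := by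
  induction d generalizing q v u j with
  | zero =>
    obtain rfl : j = 0 := by omega
    obtain rfl : q = 0 := by omega
    obtain rfl : w = v := by simpa using hw
    refine ((can_single h w u).add (can_single h w 0)).mono le_rfl ?_
    rw [pow_zero] at hu
    omega
  | succ d ih =>
    rcases j with _ | j
    · obtain rfl : w = v := by simpa using hw
      refine ((can_single h w u).add
        (can_spread_root h (d + 1) q w (by rw [pow_succ]; omega) hv hvd)).mono le_rfl ?_
      have : 0 < 2 ^ (d + 1) := by positivity
      rcases Nat.eq_zero_or_pos q with rfl | hq0
      · omega
      · have hb : ∀ q, 0 < q → 0 < bitSum q := by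
          intro q
          induction q using Nat.strong_induction_on with
          | _ q ihq =>
            intro hq
            have h1 := bitSum_eq q
            rcases Nat.eq_zero_or_pos (q / 2) with h0 | h0
            · omega
            · have := ihq (q / 2) (by omega) h0
              omega
        have := hb q hq0
        omega
    · rw [pow_succ] at hq hu
      have e : (v + 1) * 2 ^ (d + 1) = (2 * v + 1 + 1) * 2 ^ d := by ring
      have hR : (2 * v + 1 + 1) * 2 ^ d ≤ 2 ^ (h + 1) := e ▸ hvd
      have hL : (2 * v + 1) * 2 ^ d ≤ 2 ^ (h + 1) :=
        (Nat.mul_le_mul_right _ (Nat.le_succ _)).trans hR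
      have hlt' : 2 * v + 1 < 2 ^ (h + 1) :=
        (Nat.lt_succ_self _).trans_le ((Nat.le_mul_of_pos_right _ (by positivity)).trans hR)
      have hw2 : w / 2 ^ j / 2 = v := by rw [Nat.div_div_eq_div_mul, ← pow_succ, hw]
      have hb := bitSum_eq q
      have main : ∀ c c' : ℕ, w / 2 ^ j = c → c / 2 = v → c' / 2 = v →
          (c + 1) * 2 ^ d ≤ 2 ^ (h + 1) → (c' + 1) * 2 ^ d ≤ 2 ^ (h + 1) →
          Can h (Pi.single v u + (Pi.single v (2 * (q % 2)) + spread d (q / 2) c') +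
            spread d (q / 2) c) w 1 := by
        intro c c' hwc hc hc' hcd hcd'
        have h1 := (can_spread_root h d (q / 2) c' (by rw [pow_succ]; omega) (by omega) hcd').move
          (w := v) (by omega) (by omega) (by omega)
        have h2 := ((can_single h v u).add ((can_single h v (2 * (q % 2))).add h1)).move
          (w := c) (by omega) (by omega) (by omega)
        exact h2.trans (ih (q / 2) c _ j (by omega) (by omega) hcd (by omega) (by omega) hwc)
      have hc : w / 2 ^ j = 2 * v ∨ w / 2 ^ j = 2 * v + 1 := by omega
      rcases hc with hc | hc
      · convert main (2 * v) (2 * v + 1) hc (by omega) (by omega) hL hR using 1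
        rw [spread]
        abel
      · convert main (2 * v + 1) (2 * v) hc (by omega) (by omega) hR hL using 1
        rw [spread]
        abel

theorem exists_pebbles (h m : ℕ) (hm : m ≤ 2 ^ h) (hN : 2 ^ h ≤ m + fiveRank (m / 4)) :
    ∃ f : ℕ → ℕ, Pebbles h f ∧ ∑ v ∈ Finset.Ico 1 (2 ^ (h + 1)), f v = m := by
  have hpos : 0 < 2 ^ h := by positivity
  have hs : 2 ^ (h + 1) = 2 * 2 ^ h := pow_succ' 2 h
  have hq : m / 2 < 2 ^ h := by omega
  refine ⟨Pi.single 1 (m % 2) + spread h (m / 2) 1, fun w hw1 hw2 => ?_, ?_⟩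
  · have h1 := fiveRank_add_bitSum (m / 4)
    have h2 := bitSum_eq (m / 2)
    rw [show m / 2 / 2 = m / 4 by omega] at h2
    refine can_spread h h (m / 2) 1 (m % 2) w (Nat.log 2 w) hq le_rfl (by omega) (by omega) ?_ ?_
    · exact Nat.lt_succ_iff.1 (Nat.log_lt_of_lt_pow (by omega) hw2)
    · have hl := Nat.pow_log_le_self 2 (x := w) (by omega)
      have hr := Nat.lt_pow_succ_log_self one_lt_two w
      refine Nat.div_eq_of_lt_le (by omega) ?_
      rw [pow_succ] at hr
      omega
  · simp only [Pi.add_apply, Finset.sum_add_distrib]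
    rw [sum_spread h h (m / 2) 1 (by omega) le_rfl (by omega), Finset.sum_pi_single',
      if_pos (Finset.mem_Ico.2 (by omega))]
    omega

/-! ### Bounding what can be moved -/

/-- The number of pebbles `f` can bring to `v` inside the subtree rooted at `v`. -/
def upFlow (h : ℕ) (f : ℕ → ℕ) (v : ℕ) : ℕ :=
  if 1 ≤ v ∧ v < 2 ^ (h + 1) then
    f v + upFlow h f (2 * v) / 2 + upFlow h f (2 * v + 1) / 2
  else 0
termination_by 2 ^ (h + 1) - v

/-- The number of pebbles `f` can bring to `v` from outside the subtree rooted at `v`. -/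
def downFlow (h : ℕ) (f : ℕ → ℕ) (v : ℕ) : ℕ :=
  if 2 ≤ v then
    (downFlow h f (v / 2) + f (v / 2) +
      upFlow h f (if v % 2 = 0 then v + 1 else v - 1) / 2) / 2
  else 0
termination_by v

/-- The number of pebbles of `f` on the subtree rooted at `v`. -/
def mass (h : ℕ) (f : ℕ → ℕ) (v : ℕ) : ℕ :=
  if 1 ≤ v ∧ v < 2 ^ (h + 1) then f v + mass h f (2 * v) + mass h f (2 * v + 1) else 0
termination_by 2 ^ (h + 1) - v

theorem upFlow_of_up {h : ℕ} {f g : ℕ → ℕ} {c : ℕ} (hc : 2 ≤ c) (hch : c < 2 ^ (h + 1))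
    (hfc : 2 ≤ f c) (hg : ∀ w, g w = if w = c then f c - 2 else if w = c / 2 then f (c / 2) + 1
      else f w) (z : ℕ) : upFlow h g z + (if z = c then 2 else 0) ≤ upFlow h f z := by
  induction hn : 2 ^ (h + 1) - z using Nat.strong_induction_on generalizing z with
  | _ n ih =>
    subst hn
    rw [upFlow, upFlow.eq_1 h f]
    split_ifs with h1 h2 h2
    · have i1 := ih _ (by omega) (2 * z) rfl
      have i2 := ih _ (by omega) (2 * z + 1) rfl
      have i3 := hg z
      subst h2
      rw [if_pos rfl] at i3
      rw [if_neg (by omega)] at i1 i2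
      omega
    · have i1 := ih _ (by omega) (2 * z) rfl
      have i2 := ih _ (by omega) (2 * z + 1) rfl
      have i3 := hg z
      rw [if_neg h2] at i3
      split_ifs at i3 with h3
      · subst h3
        split_ifs at i1 i2 <;> omega
      · rw [if_neg (by omega)] at i1 i2
        omega
    · omega
    · omega

theorem downFlow_of_up {h : ℕ} {f g : ℕ → ℕ} {c : ℕ} (hc : 2 ≤ c) (hch : c < 2 ^ (h + 1))
    (hfc : 2 ≤ f c) (hg : ∀ w, g w = if w = c then f c - 2 else if w = c / 2 then f (c / 2) + 1
      else f w) (z : ℕ) : downFlow h g z ≤ downFlow h f z + (if z = c then 1 else 0) := by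
  induction z using Nat.strong_induction_on with
  | _ z ih =>
    rw [downFlow, downFlow.eq_1 h f]
    split_ifs with h1 h2 h3 h3 h3 <;> try omega
    all_goals
      have i1 := ih (z / 2) (by omega)
      have i2 := upFlow_of_up hc hch hfc hg (if z % 2 = 0 then z + 1 else z - 1)
      have i3 := hg (z / 2)
      simp only [h2, if_true, if_false] at i2
      split_ifs at i1 i2 i3 <;> simp_all <;> omega

theorem upFlow_of_down {h : ℕ} {f g : ℕ → ℕ} {c : ℕ} (hc : 2 ≤ c) (hch : c < 2 ^ (h + 1))
    (hfc : 2 ≤ f (c / 2)) (hg : ∀ w, g w = if w = c / 2 then f (c / 2) - 2 else if w = c then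
      f c + 1 else f w) (z : ℕ) : upFlow h g z ≤ upFlow h f z + (if z = c then 1 else 0) := by
  induction hn : 2 ^ (h + 1) - z using Nat.strong_induction_on generalizing z with
  | _ n ih =>
    subst hn
    rw [upFlow, upFlow.eq_1 h f]
    split_ifs with h1 h2 h2
    · have i1 := ih _ (by omega) (2 * z) rfl
      have i2 := ih _ (by omega) (2 * z + 1) rfl
      have i3 := hg z
      subst h2
      rw [if_neg (by omega), if_pos rfl] at i3
      rw [if_neg (by omega)] at i1 i2
      omega
    · have i1 := ih _ (by omega) (2 * z) rfl
      have i2 := ih _ (by omega) (2 * z + 1) rfl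
      have i3 := hg z
      rw [if_neg h2] at i3
      split_ifs at i3 with h3
      · subst h3
        split_ifs at i1 i2 <;> omega
      · rw [if_neg (by omega)] at i1 i2
        omega
    · omega
    · omega

theorem downFlow_of_down {h : ℕ} {f g : ℕ → ℕ} {c : ℕ} (hc : 2 ≤ c) (hch : c < 2 ^ (h + 1))
    (hfc : 2 ≤ f (c / 2)) (hg : ∀ w, g w = if w = c / 2 then f (c / 2) - 2 else if w = c then
      f c + 1 else f w) (z : ℕ) : downFlow h g z + (if z = c then 1 else 0) ≤ downFlow h f z := by
  induction z using Nat.strong_induction_on with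
  | _ z ih =>
    rw [downFlow, downFlow.eq_1 h f]
    split_ifs with h1 h2 h3 h3 h3 <;> try omega
    all_goals
      have i1 := ih (z / 2) (by omega)
      have i2 := upFlow_of_down hc hch hfc hg (if z % 2 = 0 then z + 1 else z - 1)
      have i3 := hg (z / 2)
      simp only [h2, if_true, if_false] at i2
      split_ifs at i1 i2 i3 <;> simp_all <;> omega

theorem PebMove.flow_le {h : ℕ} {f g : ℕ → ℕ} (m : PebMove h f g) (z : ℕ) :
    downFlow h g z + upFlow h g z ≤ downFlow h f z + upFlow h f z := by
  obtain ⟨u, v, hu, hv, huv, h2, rfl⟩ := m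
  rcases huv with rfl | rfl
  · have h1 := upFlow_of_down (h := h) (by omega) hv.2 h2 (fun w => rfl) z
    have h3 := downFlow_of_down (h := h) (by omega) hv.2 h2 (fun w => rfl) z
    omega
  · have h1 := upFlow_of_up (h := h) (by omega) hu.2 h2 (fun w => rfl) z
    have h3 := downFlow_of_up (h := h) (by omega) hu.2 h2 (fun w => rfl) z
    split_ifs at h1 h3 <;> omega

theorem Can.le_flow {h : ℕ} {f : ℕ → ℕ} {v n : ℕ} (c : Can h f v n)
    (hv : 1 ≤ v ∧ v < 2 ^ (h + 1)) : n ≤ downFlow h f v + upFlow h f v := by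
  obtain ⟨g, hg, hn⟩ := c
  have h1 : downFlow h g v + upFlow h g v ≤ downFlow h f v + upFlow h f v := by
    clear hn
    induction hg with
    | refl => exact le_rfl
    | tail _ m ih => exact (m.flow_le v).trans ih
  have h2 : g v ≤ upFlow h g v := by
    rw [upFlow, if_pos hv]
    omega
  omega

/-! ### The lower bound -/

/-- The least weight `∑ yᵢ` of a representation `m = ∑ 2 ^ i * yᵢ` with `yᵢ` even for `i ≥ 1`. -/
def evenWeight (m : ℕ) : ℕ := 2 * bitSum (m / 2) + m % 2

theorem evenWeight_two_mul (m : ℕ) : evenWeight (2 * m) = evenWeight m + m % 2 := by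
  have := bitSum_eq m
  simp only [evenWeight, Nat.mul_div_cancel_left m two_pos]
  omega

theorem evenWeight_add_le (m k : ℕ) : evenWeight (m + k) ≤ evenWeight m + k := by
  induction k with
  | zero => rfl
  | succ k ih =>
    have h1 := bitSum_succ_le ((m + k) / 2)
    rcases Nat.even_or_odd' (m + k) with ⟨a, ha | ha⟩
    · have : (m + (k + 1)) / 2 = (m + k) / 2 := by omega
      unfold evenWeight at *
      rw [this]
      omega
    · have : (m + (k + 1)) / 2 = (m + k) / 2 + 1 := by omega
      unfold evenWeight at *
      rw [this]
      omega

theorem evenWeight_mod_two (m : ℕ) : evenWeight m % 2 = m % 2 := by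
  unfold evenWeight
  omega

theorem evenWeight_add_le_flow {u x m₁ m₂ a₁ a₂ n : ℕ}
    (h₁ : a₁ + n ≤ 2 * ((u + x + a₂ / 2) / 2) + 3 * m₁)
    (h₂ : a₂ + n ≤ 2 * ((u + x + a₁ / 2) / 2) + 3 * m₂)
    (h₁' : evenWeight m₁ + n ≤ 2 * ((u + x + a₂ / 2) / 2) + 3 * m₁)
    (h₂' : evenWeight m₂ + n ≤ 2 * ((u + x + a₁ / 2) / 2) + 3 * m₂) (hn : n % 2 = 0) :
    evenWeight (x + m₁ + m₂) + 2 * n ≤ 2 * u + 3 * (x + m₁ + m₂) := by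
  have p₁ := evenWeight_mod_two m₁
  have p₂ := evenWeight_mod_two m₂
  rcases le_total m₁ m₂ with hm | hm
  · have e₁ := evenWeight_add_le (2 * m₁) (x + (m₂ - m₁))
    rw [evenWeight_two_mul, show 2 * m₁ + (x + (m₂ - m₁)) = x + m₁ + m₂ by omega] at e₁
    omega
  · have e₁ := evenWeight_add_le (2 * m₂) (x + (m₁ - m₂))
    rw [evenWeight_two_mul, show 2 * m₂ + (x + (m₁ - m₂)) = x + m₁ + m₂ by omega] at e₁
    omega

theorem flow_le_mass {h : ℕ} {f : ℕ → ℕ} (hf : Pebbles h f) (d v : ℕ) (hd : d ≤ h)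
    (hv : 2 ^ (h - d) ≤ v ∧ v < 2 ^ (h - d + 1)) :
    upFlow h f v + 2 ^ (d + 1) ≤ 2 * downFlow h f v + 3 * mass h f v ∧
      evenWeight (mass h f v) + 2 ^ (d + 1) ≤ 2 * downFlow h f v + 3 * mass h f v := by
  have hpos : 0 < 2 ^ (h - d) := by positivity
  have hle : 2 ^ (h - d + 1) ≤ 2 ^ (h + 1) := Nat.pow_le_pow_right two_pos (by omega)
  have hr : 1 ≤ v ∧ v < 2 ^ (h + 1) := by omega
  induction d generalizing v with
  | zero =>
    have h1 := Can.le_flow (hf v hr.1 hr.2) hr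
    have hout : ∀ w, 2 ^ (h + 1) ≤ w → upFlow h f w = 0 ∧ mass h f w = 0 := by
      intro w hw
      rw [upFlow, mass, if_neg (by omega), if_neg (by omega)]
      exact ⟨rfl, rfl⟩
    have hp : 2 ^ (h + 1) = 2 * 2 ^ h := pow_succ' 2 h
    rw [Nat.sub_zero] at hv
    obtain ⟨u1, m1⟩ := hout (2 * v) (by omega)
    obtain ⟨u2, m2⟩ := hout (2 * v + 1) (by omega)
    have hu : upFlow h f v = f v := by rw [upFlow, if_pos hr, u1, u2]; rfl
    have hm : mass h f v = f v := by rw [mass, if_pos hr, m1, m2]; rfl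
    have hc := evenWeight_add_le 0 (f v)
    rw [zero_add, show evenWeight 0 = 0 by simp [evenWeight, bitSum_zero]] at hc
    rw [hu] at h1
    rw [hu, hm, zero_add, pow_one]
    omega
  | succ d ih =>
    have e1 : h - d = h - (d + 1) + 1 := by omega
    have e2 : 2 ^ (h - d) = 2 * 2 ^ (h - (d + 1)) := by rw [e1, pow_succ']
    have e3 : 2 ^ (h - d + 1) = 2 * 2 ^ (h - d) := pow_succ' 2 _
    have e4 : 2 ^ (h - (d + 1) + 1) = 2 * 2 ^ (h - (d + 1)) := pow_succ' 2 _
    have hle' : 2 ^ (h - d + 1) ≤ 2 ^ (h + 1) := Nat.pow_le_pow_right two_pos (by omega)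
    obtain ⟨a1, b1⟩ := ih (2 * v) (by omega) (by omega) (by omega) hle' (by omega)
    obtain ⟨a2, b2⟩ := ih (2 * v + 1) (by omega) (by omega) (by omega) hle' (by omega)
    have d1 : downFlow h f (2 * v) = (downFlow h f v + f v + upFlow h f (2 * v + 1) / 2) / 2 := by
      rw [downFlow, if_pos (by omega), if_pos (by omega), show 2 * v / 2 = v by omega]
    have d2 : downFlow h f (2 * v + 1) = (downFlow h f v + f v + upFlow h f (2 * v) / 2) / 2 := by
      rw [downFlow, if_pos (by omega), if_neg (by omega), show (2 * v + 1) / 2 = v by omega,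
        Nat.add_sub_cancel]
    have hp : 2 ^ (d + 1 + 1) = 2 * 2 ^ (d + 1) := pow_succ' 2 _
    have hp' : 2 ^ (d + 1) = 2 * 2 ^ d := pow_succ' 2 _
    rw [d1] at a1 b1
    rw [d2] at a2 b2
    have hm : mass h f v = f v + mass h f (2 * v) + mass h f (2 * v + 1) := by
      rw [mass, if_pos hr]
    have hu : upFlow h f v = f v + upFlow h f (2 * v) / 2 + upFlow h f (2 * v + 1) / 2 := by
      rw [upFlow, if_pos hr]
    rw [hm, hu, hp]
    exact ⟨by omega, evenWeight_add_le_flow a1 a2 b1 b2 (by omega)⟩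

theorem sum_Ico_mass (h : ℕ) (f : ℕ → ℕ) (d : ℕ) (hd : d ≤ h) :
    ∑ v ∈ Finset.Ico (2 ^ (h - d)) (2 ^ (h - d + 1)), mass h f v =
      ∑ v ∈ Finset.Ico (2 ^ (h - d)) (2 ^ (h + 1)), f v := by
  induction d with
  | zero =>
    have hpos : 0 < 2 ^ h := by positivity
    have hp : 2 ^ (h + 1) = 2 * 2 ^ h := pow_succ' 2 h
    refine Finset.sum_congr rfl fun v hv => ?_
    rw [Nat.sub_zero, Finset.mem_Ico] at hv
    rw [mass, if_pos (by omega), mass, if_neg (by omega), mass, if_neg (by omega)]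
    rfl
  | succ d ih =>
    obtain ⟨k, rfl⟩ : ∃ k, h = d + 1 + k := Nat.exists_eq_add_of_le hd
    have ih := ih (by omega)
    rw [show d + 1 + k - d = k + 1 by omega] at ih
    rw [show d + 1 + k - (d + 1) = k by omega]
    have hpos : 0 < 2 ^ k := by positivity
    have hle : 2 ^ (k + 1) ≤ 2 ^ (d + 1 + k + 1) := Nat.pow_le_pow_right two_pos (by omega)
    have hp : 2 ^ (k + 1) = 2 * 2 ^ k := pow_succ' 2 k
    have hsplit : ∀ (F : ℕ → ℕ) (a b : ℕ), ∑ v ∈ Finset.Ico (2 * a) (2 * (a + b)), F v =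
        ∑ v ∈ Finset.Ico a (a + b), (F (2 * v) + F (2 * v + 1)) := by
      intro F a b
      induction b with
      | zero => simp
      | succ b ihb =>
        rw [← add_assoc, Finset.sum_Ico_succ_top (by omega), ← ihb,
          show 2 * (a + b + 1) = 2 * (a + b) + 1 + 1 by ring,
          Finset.sum_Ico_succ_top (by omega), Finset.sum_Ico_succ_top (by omega), add_assoc]
    have h1 := hsplit (mass (d + 1 + k) f) (2 ^ k) (2 ^ k)
    rw [show 2 * (2 ^ k + 2 ^ k) = 2 ^ (k + 1 + 1) by ring,
      show 2 ^ k + 2 ^ k = 2 ^ (k + 1) by ring, ← hp, ih] at h1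
    rw [← Finset.sum_Ico_consecutive f (Nat.pow_le_pow_right two_pos (Nat.le_succ k)) hle, h1,
      ← Finset.sum_add_distrib]
    refine Finset.sum_congr rfl fun v hv => ?_
    rw [Finset.mem_Ico] at hv
    rw [mass, if_pos (by omega), add_assoc]

theorem le_of_pebbles {h : ℕ} {f : ℕ → ℕ} (hf : Pebbles h f) {m : ℕ}
    (hm : ∑ v ∈ Finset.Ico 1 (2 ^ (h + 1)), f v = m) : 2 ^ h ≤ m + fiveRank (m / 4) := by
  have h1 := (flow_le_mass hf h 1 le_rfl (by simp)).2
  have h2 := sum_Ico_mass h f h le_rfl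
  simp only [Nat.sub_self, pow_zero, zero_add, pow_one, Nat.Ico_succ_singleton,
    Finset.sum_singleton, hm] at h2
  rw [h2, downFlow, if_neg (by omega)] at h1
  have h4 := fiveRank_add_bitSum (m / 4)
  have h5 := bitSum_eq (m / 2)
  rw [show m / 2 / 2 = m / 4 by omega] at h5
  have h6 : 2 ^ (h + 1) = 2 * 2 ^ h := pow_succ' 2 h
  unfold evenWeight at h1
  omega

/-- The optimal pebbling number of the complete binary tree `T^h` of height
`h ≥ 1` is `2^h − k(h)`, where `k(h) = max{k : s(k) ≤ 2^h}`: the minimum, over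
all pebbling configurations `f` that pebble `T^h`, of the total number of
pebbles of `f`, equals `2^h − k(h)`. -/
theorem optimal_pebbling_number (h : ℕ) (hh : 1 ≤ h) :
    IsLeast {p : ℕ | ∃ f : ℕ → ℕ, Pebbles h f ∧
        ∑ v ∈ Finset.Ico 1 (2 ^ (h + 1)), f v = p}
      (2 ^ h - kOf h) := by 
  have hk : kOf h ≤ 2 ^ h := Nat.findGreatest_le _
  have hs : s (kOf h) ≤ 2 ^ h :=
    Nat.findGreatest_spec (P := fun k => s k ≤ 2 ^ h) (Nat.zero_le _) (by simp [s])
  constructor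
  · have := (s_le_iff hk).1 hs
    exact exists_pebbles h _ (Nat.sub_le _ _) (by omega)
  · rintro m ⟨f, hf, hm⟩
    by_contra! hlt
    have hN := le_of_pebbles hf hm
    have hle : 2 ^ h - m ≤ kOf h := by
      refine Nat.le_findGreatest (Nat.sub_le _ _) ((s_le_iff (Nat.sub_le _ _)).2 ?_)
      rw [show 2 ^ h - (2 ^ h - m) = m by omega]
      omega
    omega
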